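/- Let G=(V,E) be a supply graph and H=(V,D) a demand graph with G+H connected. Then there exists an integral feasible solution y ∈ {0,1,2,...}^{D∪E} of the D-cut covering LP (minimize Σ_{e∈D∪E} y_e subject to Σ_{e∈δ(U)} y_e ≥ 1 for every vertex set U such that δ(U) is a D-cut, and y ≥ 0) whose value is at most 2 times the optimum value of this LP. In other words, the integrality gap of the D-cut covering LP is at most 2. -/

import Mathlib

open scoped Classical

noncomputable section

/-- The edge set of a simple closed walk in the multigraph with endpoint map `ends`. -/
def IsCycle {V ε : Type} (ends : ε → Sym2 V) (C : Finset ε) : Prop :=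
  ∃ (n : ℕ) (v : Fin (n + 1) → V) (e : Fin (n + 1) → ε),
    Function.Injective v ∧ Function.Injective e ∧
    (∀ i, ends (e i) = s(v i, v (i + 1))) ∧
    C = Finset.image e Finset.univ

/-- The edge set of a simple (open) path. -/
def IsPath {V ε : Type} (ends : ε → Sym2 V) (P : Finset ε) : Prop :=
  ∃ (n : ℕ) (v : Fin (n + 1) → V) (e : Fin n → ε),
    Function.Injective v ∧ Function.Injective e ∧
    (∀ i : Fin n, ends (e i) = s(v i.castSucc, v i.succ)) ∧
    P = Finset.image e Finset.univ

/-- The cut `δ(U)`: edges with exactly one endpoint in `U`. -/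
def cutF {V ε : Type} [Fintype ε] (ends : ε → Sym2 V) (U : Set V) : Finset ε :=
  Finset.univ.filter (fun e => ∃ a b, ends e = s(a, b) ∧ a ∈ U ∧ b ∉ U)

/-- `U` is nonempty and induces a connected subgraph. -/
def ConnectedOn {V ε : Type} (ends : ε → Sym2 V) (U : Set V) : Prop :=
  U.Nonempty ∧ ∀ a ∈ U, ∀ b ∈ U,
    Relation.ReflTransGen (fun x y => x ∈ U ∧ y ∈ U ∧ ∃ e, ends e = s(x, y)) a b

/-- The multigraph is connected. -/
def MGConnected {V ε : Type} (ends : ε → Sym2 V) : Prop :=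
  ConnectedOn ends Set.univ

/-- `δ(U)` is a simple cut: both sides induce connected subgraphs. -/
def IsSimpleCut {V ε : Type} (ends : ε → Sym2 V) (U : Set V) : Prop :=
  ConnectedOn ends U ∧ ConnectedOn ends Uᶜ

/-- A `D`-cycle: a cycle containing exactly one demand edge. -/
def IsDCycle {V ε : Type} [DecidableEq ε] (ends : ε → Sym2 V) (Dem : Finset ε)
    (C : Finset ε) : Prop :=
  IsCycle ends C ∧ (C ∩ Dem).card = 1

/-- A `D`-cut: a simple cut containing exactly one demand edge. -/
def IsDCut {V ε : Type} [Fintype ε] [DecidableEq ε] (ends : ε → Sym2 V) (Dem : Finset ε)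
    (U : Set V) : Prop :=
  IsSimpleCut ends U ∧ (cutF ends U ∩ Dem).card = 1

/-- Planarity of a multigraph: there is a drawing in the plane with injective vertex
positions and arcs for the edges that are internally disjoint. -/
def IsPlanar {V ε : Type} (ends : ε → Sym2 V) : Prop :=
  ∃ (pos : V → ℝ × ℝ) (arc : ε → ℝ → ℝ × ℝ),
    Function.Injective pos ∧
    (∀ e, ContinuousOn (arc e) (Set.Icc 0 1)) ∧
    (∀ e a b, ends e = s(a, b) →
      (arc e 0 = pos a ∧ arc e 1 = pos b) ∨ (arc e 0 = pos b ∧ arc e 1 = pos a)) ∧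
    (∀ e, Set.InjOn (arc e) (Set.Ico 0 1)) ∧
    (∀ e f, e ≠ f → ∀ s ∈ Set.Ioo (0:ℝ) 1, ∀ t ∈ Set.Icc (0:ℝ) 1, arc e s ≠ arc f t) ∧
    (∀ e, ∀ s ∈ Set.Ioo (0:ℝ) 1, ∀ w, arc e s ≠ pos w)

/-- The edge with endpoints `p e` and `q e` crosses the cut `δ(U)`. -/
def Crosses {V ε : Type} (p q : ε → V) (U : Finset V) (e : ε) : Prop :=
  ¬ (p e ∈ U ↔ q e ∈ U)

/-- An uncrossable set family all of whose members are nonempty and avoid the root `r`. -/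
structure IsUncrossable {V : Type} [DecidableEq V] (r : V) (𝓕 : Finset (Finset V)) : Prop where
  nonempty : ∀ U ∈ 𝓕, U.Nonempty
  root_notMem : ∀ U ∈ 𝓕, r ∉ U
  uncross : ∀ A ∈ 𝓕, ∀ B ∈ 𝓕, (A ∩ B ∈ 𝓕 ∧ A ∪ B ∈ 𝓕) ∨ (A \ B ∈ 𝓕 ∧ B \ A ∈ 𝓕)

/-- `F` covers every cut of the family `𝓕`. -/
def IsCover {V ε : Type} (p q : ε → V) (𝓕 : Finset (Finset V)) (F : Finset ε) : Prop :=
  ∀ U ∈ 𝓕, ∃ e ∈ F, Crosses p q U e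

/-- `S` assigns to each edge `e ∈ F` a set of `𝓕` whose cut meets `F` exactly in `e`. -/
def IsWitness {V ε : Type} (p q : ε → V) (𝓕 : Finset (Finset V)) (F : Finset ε)
    (S : ε → Finset V) : Prop :=
  ∀ e ∈ F, S e ∈ 𝓕 ∧ ∀ f ∈ F, Crosses p q (S e) f ↔ f = e

/-- The inclusion-minimal members of a set family. -/
def minimalSets {V : Type} (𝓕 : Finset (Finset V)) : Finset (Finset V) :=
  𝓕.filter fun C => ∀ B ∈ 𝓕, B ⊆ C → B = C

theorem mem_minimalSets {V : Type} {𝓕 : Finset (Finset V)} {C : Finset V} :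
    C ∈ minimalSets 𝓕 ↔ C ∈ 𝓕 ∧ ∀ B ∈ 𝓕, B ⊆ C → B = C := by
  simp [minimalSets]

theorem exists_minimalSets_subset {V : Type} {𝓕 : Finset (Finset V)} {U : Finset V}
    (hU : U ∈ 𝓕) : ∃ C ∈ minimalSets 𝓕, C ⊆ U := by
  obtain ⟨C, hCU, hC⟩ := 𝓕.exists_le_minimal hU
  exact ⟨C, mem_minimalSets.2 ⟨hC.prop, fun B hB hBC => (hC.eq_of_le hB hBC)⟩, hCU⟩

theorem IsUncrossable.subset_of_mem {V : Type} [DecidableEq V] {r : V} {𝓕 : Finset (Finset V)}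
    (h : IsUncrossable r 𝓕) {C U : Finset V} (hC : C ∈ minimalSets 𝓕) (hU : U ∈ 𝓕) {x : V}
    (hxC : x ∈ C) (hxU : x ∈ U) : C ⊆ U := by
  rw [mem_minimalSets] at hC
  rcases h.uncross C hC.1 U hU with h1 | h1
  · exact Finset.inter_eq_left.1 (hC.2 _ h1.1 Finset.inter_subset_left)
  · have := hC.2 _ h1.1 Finset.sdiff_subset
    rw [← this] at hxC
    exact absurd hxU (Finset.mem_sdiff.1 hxC).2

theorem sum_lt_sum_of_pair {ε : Type} [DecidableEq ε] {F : Finset ε} {g g' : ε → ℕ} {a b : ε}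
    (ha : a ∈ F) (hb : b ∈ F) (hab : a ≠ b) (h : ∀ e, e ≠ a → e ≠ b → g' e = g e)
    (hlt : g' a + g' b < g a + g b) : ∑ e ∈ F, g' e < ∑ e ∈ F, g e := by
  have hb' : b ∈ F.erase a := Finset.mem_erase.2 ⟨hab.symm, hb⟩
  have hs : ∑ e ∈ (F.erase a).erase b, g' e = ∑ e ∈ (F.erase a).erase b, g e :=
    Finset.sum_congr rfl fun e he => by
      simp only [Finset.mem_erase] at he
      exact h e he.2.1 he.1
  rw [← Finset.add_sum_erase F g' ha, ← Finset.add_sum_erase F g ha,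
    ← Finset.add_sum_erase _ g' hb', ← Finset.add_sum_erase _ g hb', hs]
  omega

/-- Both ways of uncrossing decrease the number of separated pairs of vertices. -/
theorem card_mul_card_compl_uncross {V : Type} [Fintype V] [DecidableEq V] {A B : Finset V} {r : V}
    (hrA : r ∉ A) (hrB : r ∉ B) (hAB : ¬ A ⊆ B) (hBA : ¬ B ⊆ A) (hd : (A ∩ B).Nonempty) :
    (A ∩ B).card * (A ∩ B)ᶜ.card + (A ∪ B).card * (A ∪ B)ᶜ.card
        < A.card * Aᶜ.card + B.card * Bᶜ.card ∧
      (A \ B).card * (A \ B)ᶜ.card + (B \ A).card * (B \ A)ᶜ.card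
        < A.card * Aᶜ.card + B.card * Bᶜ.card := by
  have h1 := Finset.card_sdiff_add_card_inter A B
  have h2 := Finset.card_sdiff_add_card_inter B A
  rw [Finset.inter_comm B A] at h2
  have h3 := Finset.card_union_add_card_inter A B
  have hA := Finset.card_add_card_compl A
  have hB := Finset.card_add_card_compl B
  have hI := Finset.card_add_card_compl (A ∩ B)
  have hU := Finset.card_add_card_compl (A ∪ B)
  have hX := Finset.card_add_card_compl (A \ B)
  have hY := Finset.card_add_card_compl (B \ A)
  have pX : 0 < (A \ B).card := Finset.card_pos.2 (Finset.sdiff_nonempty.2 hAB)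
  have pY : 0 < (B \ A).card := Finset.card_pos.2 (Finset.sdiff_nonempty.2 hBA)
  have pI : 0 < (A ∩ B).card := Finset.card_pos.2 hd
  have pO : 0 < (A ∪ B)ᶜ.card := Finset.card_pos.2 ⟨r, by simp [hrA, hrB]⟩
  generalize (A \ B).card = x at *
  generalize (B \ A).card = y at *
  generalize (A ∩ B).card = i at *
  generalize (A ∪ B)ᶜ.card = o at *
  have eA : A.card = x + i := by omega
  have eB : B.card = y + i := by omega
  have eU : (A ∪ B).card = x + y + i := by omega
  have eA' : Aᶜ.card = y + o := by omega
  have eB' : Bᶜ.card = x + o := by omega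
  have eI' : (A ∩ B)ᶜ.card = x + y + o := by omega
  have eX' : (A \ B)ᶜ.card = i + y + o := by omega
  have eY' : (B \ A)ᶜ.card = i + x + o := by omega
  rw [eA, eB, eU, eA', eB', eI', eX', eY']
  have := Nat.mul_pos pX pY
  have := Nat.mul_pos pI pO
  constructor <;> nlinarith

/-- Two edges whose witness sets cross can exchange them for a less crossing pair. -/
theorem IsWitness.exists_uncross {V ε : Type} [Fintype V] [DecidableEq V] {p q : ε → V} {r : V}
    {𝓕 : Finset (Finset V)} (h𝓕 : IsUncrossable r 𝓕) {F : Finset ε} (hF : IsCover p q 𝓕 F)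
    {S : ε → Finset V} (hS : IsWitness p q 𝓕 F S) {a b : ε} (ha : a ∈ F) (hb : b ∈ F)
    (hab : ¬ S a ⊆ S b) (hba : ¬ S b ⊆ S a) (hd : ¬ Disjoint (S a) (S b)) :
    ∃ X Y, X ∈ 𝓕 ∧ Y ∈ 𝓕 ∧ (∀ f ∈ F, Crosses p q X f ↔ f = a) ∧
      (∀ f ∈ F, Crosses p q Y f ↔ f = b) ∧
      X.card * Xᶜ.card + Y.card * Yᶜ.card
        < (S a).card * (S a)ᶜ.card + (S b).card * (S b)ᶜ.card := by
  obtain ⟨hA, hAc⟩ := hS a ha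
  obtain ⟨hB, hBc⟩ := hS b hb
  rw [Finset.not_disjoint_iff_nonempty_inter] at hd
  obtain ⟨hlt1, hlt2⟩ := card_mul_card_compl_uncross (h𝓕.root_notMem _ hA)
    (h𝓕.root_notMem _ hB) hab hba hd
  have hne : a ≠ b := fun h => hab (h ▸ subset_rfl)
  generalize S a = A at *
  generalize S b = B at *
  have key : ∀ X Y : Finset V, X ∈ 𝓕 → Y ∈ 𝓕 →
      (∀ f, Crosses p q X f → Crosses p q A f ∨ Crosses p q B f) →
      (∀ f, Crosses p q Y f → Crosses p q A f ∨ Crosses p q B f) →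
      (∀ f, Crosses p q X f → Crosses p q Y f → Crosses p q A f ∧ Crosses p q B f) →
      (∀ f ∈ F, Crosses p q X f ↔ f = a) ∧ (∀ f ∈ F, Crosses p q Y f ↔ f = b) ∨
      (∀ f ∈ F, Crosses p q X f ↔ f = b) ∧ (∀ f ∈ F, Crosses p q Y f ↔ f = a) := by
    intro X Y hX hY h1 h2 h3
    obtain ⟨e, he, heX⟩ := hF X hX
    obtain ⟨f, hf, hfY⟩ := hF Y hY
    grind
  rcases h𝓕.uncross A hA B hB with ⟨hI, hU⟩ | ⟨hX, hY⟩
  · rcases key (A ∩ B) (A ∪ B) hI hU (by simp only [Crosses, Finset.mem_inter]; tauto)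
      (by simp only [Crosses, Finset.mem_union]; tauto)
      (by simp only [Crosses, Finset.mem_union, Finset.mem_inter]; tauto) with h | h
    · exact ⟨_, _, hI, hU, h.1, h.2, hlt1⟩
    · exact ⟨_, _, hU, hI, h.2, h.1, by omega⟩
  · rcases key (A \ B) (B \ A) hX hY (by simp only [Crosses, Finset.mem_sdiff]; tauto)
      (by simp only [Crosses, Finset.mem_sdiff]; tauto)
      (by simp only [Crosses, Finset.mem_sdiff]; tauto) with h | h
    · exact ⟨_, _, hX, hY, h.1, h.2, hlt2⟩
    · exact ⟨_, _, hY, hX, h.2, h.1, by omega⟩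

theorem IsWitness.exists_laminar {V ε : Type} [Fintype V] [DecidableEq V] [DecidableEq ε]
    {p q : ε → V} {r : V} {𝓕 : Finset (Finset V)} (h𝓕 : IsUncrossable r 𝓕) {F : Finset ε}
    (hF : IsCover p q 𝓕 F) {S : ε → Finset V} (hS : IsWitness p q 𝓕 F S) :
    ∃ T, IsWitness p q 𝓕 F T ∧
      ∀ a ∈ F, ∀ b ∈ F, T a ⊆ T b ∨ T b ⊆ T a ∨ Disjoint (T a) (T b) := by
  induction hn : ∑ e ∈ F, (S e).card * (S e)ᶜ.card using Nat.strong_induction_on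
    generalizing S with
  | _ n ih =>
    by_cases hlam : ∀ a ∈ F, ∀ b ∈ F, S a ⊆ S b ∨ S b ⊆ S a ∨ Disjoint (S a) (S b)
    · exact ⟨S, hS, hlam⟩
    push Not at hlam
    obtain ⟨a, ha, b, hb, hab, hba, hd⟩ := hlam
    obtain ⟨X, Y, hX, hY, hXa, hYb, hlt⟩ := hS.exists_uncross h𝓕 hF ha hb hab hba hd
    have hne : a ≠ b := fun h => hab (h ▸ subset_rfl)
    let T : ε → Finset V := fun e => if e = a then X else if e = b then Y else S e
    have hTa : T a = X := by simp [T]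
    have hTb : T b = Y := by simp [T, hne.symm]
    have hT : ∀ e, e ≠ a → e ≠ b → T e = S e := fun e h1 h2 => by simp [T, h1, h2]
    refine ih _ ?_ (S := T) ?_ rfl
    · rw [← hn]
      refine sum_lt_sum_of_pair ha hb hne (fun e h1 h2 => by rw [hT e h1 h2]) ?_
      simpa only [hTa, hTb] using hlt
    · intro e he
      by_cases h1 : e = a
      · subst h1
        rw [hTa]
        exact ⟨hX, hXa⟩
      by_cases h2 : e = b
      · subst h2
        rw [hTb]
        exact ⟨hY, hYb⟩
      rw [hT e h1 h2]
      exact hS e he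

/-- A minimal cover meets the cuts of the minimal sets at most twice on average. -/
theorem IsWitness.sum_card_crossing_le {V ε : Type} [Fintype V] [DecidableEq V] [DecidableEq ε]
    {p q : ε → V} {r : V} {𝓕 : Finset (Finset V)} (h𝓕 : IsUncrossable r 𝓕) {F : Finset ε}
    (hF : IsCover p q 𝓕 F) {S₀ : ε → Finset V} (hS₀ : IsWitness p q 𝓕 F S₀) :
    ∑ e ∈ F, ((minimalSets 𝓕).filter fun C => Crosses p q C e).card
      ≤ 2 * (minimalSets 𝓕).card := by
  obtain ⟨S, hS, hlam⟩ := hS₀.exists_laminar h𝓕 hF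
  have hends : ∀ e ∈ F, ∃ u v, u ∈ S e ∧ v ∉ S e ∧ (u = p e ∧ v = q e ∨ u = q e ∧ v = p e) := by
    intro e he
    have h := ((hS e he).2 e he).2 rfl
    unfold Crosses at h
    by_cases hp : p e ∈ S e
    · exact ⟨p e, q e, hp, by tauto, by tauto⟩
    · exact ⟨q e, p e, by tauto, hp, by tauto⟩
  have : ∃ u v : ε → V, ∀ e ∈ F,
      u e ∈ S e ∧ v e ∉ S e ∧ (u e = p e ∧ v e = q e ∨ u e = q e ∧ v e = p e) := by
    have : Nonempty V := ⟨r⟩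
    choose! u v h using hends
    exact ⟨u, v, h⟩
  obtain ⟨u, v, huv⟩ := this
  have hother : ∀ e ∈ F, ∀ f ∈ F, f ≠ e → (u f ∈ S e ↔ v f ∈ S e) := by
    intro e he f hf hfe
    have h := mt ((hS e he).2 f hf).1 hfe
    unfold Crosses at h
    rcases (huv f hf).2.2 with h' | h' <;> rw [h'.1, h'.2] <;> tauto
  -- `A e C`: the smallest witness set containing `C` is that of `e`
  let A : ε → Finset V → Prop := fun e C =>
    C ∈ minimalSets 𝓕 ∧ C ⊆ S e ∧ ∀ f ∈ F, C ⊆ S f → ¬ S f ⊂ S e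
  let act := F.filter fun e => ∃ C, A e C
  have hsub : ∀ C ∈ minimalSets 𝓕, ∀ e ∈ F, ∀ x ∈ C, x ∈ S e → C ⊆ S e :=
    fun C hC e he x hx hxe => h𝓕.subset_of_mem hC (hS e he).1 hx hxe
  have hinj : ∀ e ∈ F, ∀ f ∈ F, S e = S f → e = f := by
    intro e he f hf h
    have h1 := ((hS e he).2 e he).2 rfl
    rw [h] at h1
    exact ((hS f hf).2 e he).1 h1
  have hact : act.card ≤ (minimalSets 𝓕).card := by
    have : ∀ e, ∃ C, e ∈ act → A e C := by
      intro e
      by_cases h : e ∈ act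
      · obtain ⟨C, hC⟩ := (Finset.mem_filter.1 h).2
        exact ⟨C, fun _ => hC⟩
      · exact ⟨∅, fun h' => absurd h' h⟩
    choose c hc using this
    refine Finset.card_le_card_of_injOn c (fun e he => (hc e he).1) ?_
    intro e he f hf hef
    have heF := (Finset.mem_filter.1 he).1
    have hfF := (Finset.mem_filter.1 hf).1
    obtain ⟨hm, h1, h2⟩ := hc e he
    obtain ⟨-, h3, h4⟩ := hc f hf
    rw [← hef] at h3 h4
    obtain ⟨x, hx⟩ := h𝓕.nonempty _ (mem_minimalSets.1 hm).1
    refine hinj e heF f hfF ?_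
    rcases hlam e heF f hfF with h | h | h
    · by_contra hne
      exact h4 e heF h1 (Finset.ssubset_iff_subset_ne.2 ⟨h, hne⟩)
    · by_contra hne
      exact h2 f hfF h3 (Finset.ssubset_iff_subset_ne.2 ⟨h, Ne.symm hne⟩)
    · exact absurd (h3 hx) (Finset.disjoint_left.1 h (h1 hx))
  let inner := F.filter fun e => ∃ C ∈ minimalSets 𝓕, u e ∈ C
  let outer := F.filter fun e => ∃ C ∈ minimalSets 𝓕, v e ∈ C
  have hinner : inner ⊆ act := by
    intro e he
    obtain ⟨heF, C, hC, hu⟩ := Finset.mem_filter.1 he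
    refine Finset.mem_filter.2 ⟨heF, C, hC, hsub C hC e heF _ hu (huv e heF).1, ?_⟩
    intro f hf hCf hlt
    have hfe : e ≠ f := fun h => by subst h; exact lt_irrefl _ hlt
    exact (huv e heF).2.1 (hlt.1 ((hother f hf e heF hfe).1 (hCf hu)))
  -- every other witness set has a maximal witness proper subset, whose outer end is uncounted
  have hchild : ∀ e, ∃ f, e ∈ F \ act → f ∈ F \ outer ∧ S f ⊂ S e ∧
      ∀ g ∈ F, S g ⊂ S e → ¬ S f ⊂ S g := by
    intro e
    by_cases he : e ∈ F \ act
    swap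
    · exact ⟨e, fun h => absurd h he⟩
    obtain ⟨heF, hea⟩ := Finset.mem_sdiff.1 he
    have hna : ∀ C, ¬ A e C := fun C hC => hea (Finset.mem_filter.2 ⟨heF, C, hC⟩)
    obtain ⟨C, hC, hCe⟩ := exists_minimalSets_subset (hS e heF).1
    have h1 : ∃ f ∈ F, C ⊆ S f ∧ S f ⊂ S e := by
      by_contra hcon
      push Not at hcon
      exact hna C ⟨hC, hCe, hcon⟩
    obtain ⟨f₀, hf₀, -, hf₀e⟩ := h1
    obtain ⟨f, hf, hmax⟩ := (F.filter fun f => S f ⊂ S e).exists_max_image (fun f => (S f).card)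
      ⟨f₀, Finset.mem_filter.2 ⟨hf₀, hf₀e⟩⟩
    obtain ⟨hfF, hfe⟩ := Finset.mem_filter.1 hf
    have hmax' : ∀ g ∈ F, S g ⊂ S e → ¬ S f ⊂ S g := fun g hg hge hfg =>
      absurd (hmax g (Finset.mem_filter.2 ⟨hg, hge⟩)) (not_le.2 (Finset.card_lt_card hfg))
    refine ⟨f, fun _ => ⟨Finset.mem_sdiff.2 ⟨hfF, fun hfo => ?_⟩, hfe, hmax'⟩⟩
    obtain ⟨-, B, hB, hv⟩ := Finset.mem_filter.1 hfo
    have hne : f ≠ e := fun h => by subst h; exact lt_irrefl _ hfe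
    have hve : v f ∈ S e := (hother e heF f hfF hne).1 (hfe.1 (huv f hfF).1)
    refine hna B ⟨hB, hsub B hB e heF _ hv hve, fun g hg hBg hge => ?_⟩
    have hfg : f ≠ g := fun h => by subst h; exact (huv f hfF).2.1 (hBg hv)
    have hug : u f ∈ S g := (hother g hg f hfF hfg).2 (hBg hv)
    rcases hlam f hfF g hg with h | h | h
    · exact hmax' g hg hge
        (Finset.ssubset_iff_subset_ne.2 ⟨h, fun h => hfg (hinj f hfF g hg h)⟩)
    · exact (huv f hfF).2.1 (h (hBg hv))
    · exact Finset.disjoint_left.1 h (huv f hfF).1 hug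
  have houter : (F \ act).card ≤ (F \ outer).card := by
    choose c hc using hchild
    refine Finset.card_le_card_of_injOn c (fun e he => (hc e he).1) ?_
    intro e he f hf hef
    have heF := (Finset.mem_sdiff.1 he).1
    have hfF := (Finset.mem_sdiff.1 hf).1
    obtain ⟨hm, h1, h2⟩ := hc e he
    obtain ⟨-, h3, h4⟩ := hc f hf
    rw [← hef] at h3 h4
    have hcF := (Finset.mem_sdiff.1 hm).1
    by_contra hne
    rcases hlam e heF f hfF with h | h | h
    · exact h4 e heF (Finset.ssubset_iff_subset_ne.2 ⟨h, fun h => hne (hinj e heF f hfF h)⟩) h1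
    · exact h2 f hfF
        (Finset.ssubset_iff_subset_ne.2 ⟨h, fun h => hne (hinj f hfF e heF h).symm⟩) h3
    · exact Finset.disjoint_left.1 h (h1.1 (huv _ hcF).1) (h3.1 (huv _ hcF).1)
  have hdisj : ∀ x, ((minimalSets 𝓕).filter fun C => x ∈ C).card ≤ 1 := by
    intro x
    rw [Finset.card_le_one]
    intro C hC B hB
    obtain ⟨hC, hxC⟩ := Finset.mem_filter.1 hC
    obtain ⟨hB, hxB⟩ := Finset.mem_filter.1 hB
    exact (h𝓕.subset_of_mem hC (mem_minimalSets.1 hB).1 hxC hxB).antisymm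
      (h𝓕.subset_of_mem hB (mem_minimalSets.1 hC).1 hxB hxC)
  have hle : ∀ x, ((minimalSets 𝓕).filter fun C => x ∈ C).card
      ≤ if ∃ C ∈ minimalSets 𝓕, x ∈ C then 1 else 0 := by
    intro x
    split_ifs with h
    · exact hdisj x
    · push Not at h
      rw [Finset.filter_false_of_mem h, Finset.card_empty]
  have hbound : ∀ e ∈ F, ((minimalSets 𝓕).filter fun C => Crosses p q C e).card
      ≤ (if ∃ C ∈ minimalSets 𝓕, u e ∈ C then 1 else 0)
        + if ∃ C ∈ minimalSets 𝓕, v e ∈ C then 1 else 0 := by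
    intro e he
    refine le_trans ?_ (add_le_add (hle (u e)) (hle (v e)))
    refine le_trans (Finset.card_le_card ?_) (Finset.card_union_le _ _)
    intro C hC
    obtain ⟨hC, hx⟩ := Finset.mem_filter.1 hC
    unfold Crosses at hx
    rw [Finset.mem_union, Finset.mem_filter, Finset.mem_filter]
    rcases (huv e he).2.2 with h | h <;> rw [h.1, h.2] <;> tauto
  have hsum := Finset.sum_le_sum hbound
  rw [Finset.sum_add_distrib, ← Finset.card_filter, ← Finset.card_filter] at hsum
  change _ ≤ inner.card + outer.card at hsum
  have h1 := Finset.card_le_card hinner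
  have h2 : (F \ act).card + act.card = F.card :=
    Finset.card_sdiff_add_card_eq_card (Finset.filter_subset _ F)
  have h3 : (F \ outer).card + outer.card = F.card :=
    Finset.card_sdiff_add_card_eq_card (Finset.filter_subset _ F)
  omega

theorem IsUncrossable.filter_not_crosses {V ε : Type} [DecidableEq V] {r : V}
    {𝓕 : Finset (Finset V)} (h : IsUncrossable r 𝓕) (p q : ε → V) (e : ε) :
    IsUncrossable r (𝓕.filter fun U => ¬ Crosses p q U e) := by
  refine ⟨fun U hU => h.nonempty U (Finset.mem_filter.1 hU).1,
    fun U hU => h.root_notMem U (Finset.mem_filter.1 hU).1, fun A hA B hB => ?_⟩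
  obtain ⟨hA, hAe⟩ := Finset.mem_filter.1 hA
  obtain ⟨hB, hBe⟩ := Finset.mem_filter.1 hB
  simp only [Crosses, not_not] at hAe hBe
  simp only [Crosses, not_not, Finset.mem_filter, Finset.mem_inter, Finset.mem_union,
    Finset.mem_sdiff, hAe, hBe, and_true]
  exact h.uncross A hA B hB

/-- Local-ratio form of the primal-dual 2-approximation for uncrossable families: some minimal
cover costs at most twice any fractional cover. -/
theorem exists_cover_le_two_mul {V ε : Type} [Fintype V] [DecidableEq V] [Fintype ε]
    [DecidableEq ε] (p q : ε → V) (r : V) (y : ε → ℝ) (hy : ∀ e, 0 ≤ y e)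
    (𝓕 : Finset (Finset V)) (h𝓕 : IsUncrossable r 𝓕)
    (hcov : ∀ U ∈ 𝓕, 1 ≤ ∑ e with Crosses p q U e, y e)
    (w : ε → ℝ) (hw : ∀ e, 0 ≤ w e) :
    ∃ F S, IsCover p q 𝓕 F ∧ IsWitness p q 𝓕 F S ∧ ∑ e ∈ F, w e ≤ 2 * ∑ e, w e * y e := by
  induction hn : 𝓕.card using Nat.strong_induction_on generalizing 𝓕 w with
  | _ n ih =>
  rcases 𝓕.eq_empty_or_nonempty with rfl | ⟨U₀, hU₀⟩
  · refine ⟨∅, fun _ => ∅, by simp [IsCover], by simp [IsWitness], ?_⟩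
    rw [Finset.sum_empty]
    exact mul_nonneg zero_le_two (Finset.sum_nonneg fun e _ => mul_nonneg (hw e) (hy e))
  let k : ε → ℕ := fun e => ((minimalSets 𝓕).filter fun C => Crosses p q C e).card
  have hexc : ∀ U ∈ 𝓕, ∃ e, Crosses p q U e := by
    intro U hU
    by_contra hcon
    push Not at hcon
    have := hcov U hU
    rw [Finset.filter_false_of_mem fun e _ => hcon e, Finset.sum_empty] at this
    linarith
  obtain ⟨C₀, hC₀, -⟩ := exists_minimalSets_subset hU₀
  obtain ⟨e₁, he₁⟩ := hexc C₀ (mem_minimalSets.1 hC₀).1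
  have hk₁ : 0 < k e₁ := Finset.card_pos.2 ⟨C₀, Finset.mem_filter.2 ⟨hC₀, he₁⟩⟩
  obtain ⟨e₀, he₀, hmin⟩ := (Finset.univ.filter fun e => 0 < k e).exists_min_image
    (fun e => w e / k e) ⟨e₁, by simpa using hk₁⟩
  have hk₀ : 0 < k e₀ := (Finset.mem_filter.1 he₀).2
  obtain ⟨C₁, hC₁⟩ := Finset.card_pos.1 hk₀
  obtain ⟨hC₁, hC₁e⟩ := Finset.mem_filter.1 hC₁
  set t : ℝ := w e₀ / k e₀ with ht
  have ht0 : 0 ≤ t := div_nonneg (hw _) (Nat.cast_nonneg _)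
  have hw' : ∀ e, 0 ≤ w e - t * k e := by
    intro e
    rcases Nat.eq_zero_or_pos (k e) with h | h
    · simpa [h] using hw e
    · have := hmin e (by simpa using h)
      rw [le_div_iff₀ (by exact_mod_cast h)] at this
      linarith
  have hw₀ : w e₀ - t * k e₀ = 0 := by
    rw [ht, div_mul_cancel₀ _ (by exact_mod_cast hk₀.ne'), sub_self]
  have hsubF : ∀ U, U ∈ 𝓕.filter (fun U => ¬ Crosses p q U e₀) ↔ U ∈ 𝓕 ∧ ¬ Crosses p q U e₀ :=
    fun U => Finset.mem_filter
  have h𝓕' := h𝓕.filter_not_crosses p q e₀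
  obtain ⟨F', S, hF', hS, hle⟩ := ih _ (by
      rw [← hn]
      refine Finset.card_lt_card (Finset.filter_ssubset.2 ⟨C₁, (mem_minimalSets.1 hC₁).1, ?_⟩)
      exact not_not.2 hC₁e) _ h𝓕'
    (fun U hU => hcov U ((hsubF U).1 hU).1) (fun e => w e - t * k e) hw' rfl
  have hS𝓕 : IsWitness p q 𝓕 F' S := fun e he => ⟨((hsubF _).1 (hS e he).1).1, (hS e he).2⟩
  obtain ⟨F, T, hF, hT, hwF⟩ : ∃ F T, IsCover p q 𝓕 F ∧ IsWitness p q 𝓕 F T ∧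
      ∑ e ∈ F, (w e - t * k e) = ∑ e ∈ F', (w e - t * k e) := by
    by_cases hcF : IsCover p q 𝓕 F'
    · exact ⟨F', S, hcF, hS𝓕, rfl⟩
    unfold IsCover at hcF
    push Not at hcF
    obtain ⟨W, hW, hWF⟩ := hcF
    have he₀F : e₀ ∉ F' := fun h =>
      ((hsubF _).1 (hS e₀ h).1).2 (((hS e₀ h).2 e₀ h).2 rfl)
    have hWe : Crosses p q W e₀ := by
      by_contra h
      obtain ⟨e, he, hx⟩ := hF' W ((hsubF W).2 ⟨hW, h⟩)
      exact hWF e he hx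
    refine ⟨insert e₀ F', fun e => if e = e₀ then W else S e, ?_, ?_, ?_⟩
    · intro U hU
      by_cases h : Crosses p q U e₀
      · exact ⟨e₀, Finset.mem_insert_self _ _, h⟩
      · obtain ⟨e, he, hx⟩ := hF' U ((hsubF U).2 ⟨hU, h⟩)
        exact ⟨e, Finset.mem_insert_of_mem he, hx⟩
    · intro e he
      by_cases h : e = e₀
      · subst h
        simp only [if_true]
        refine ⟨hW, fun f hf => ?_⟩
        rcases Finset.mem_insert.1 hf with rfl | hf
        · simpa using hWe
        · exact iff_of_false (hWF f hf) fun h => he₀F (h ▸ hf)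
      · have heF : e ∈ F' := (Finset.mem_insert.1 he).resolve_left h
        simp only [if_neg h]
        refine ⟨(hS𝓕 e heF).1, fun f hf => ?_⟩
        rcases Finset.mem_insert.1 hf with rfl | hf
        · exact iff_of_false ((hsubF _).1 (hS e heF).1).2 (Ne.symm h)
        · exact (hS e heF).2 f hf
    · rw [Finset.sum_insert he₀F, hw₀, zero_add]
  refine ⟨F, T, hF, hT, ?_⟩
  have h1 : ((∑ e ∈ F, k e : ℕ) : ℝ) ≤ ((2 * (minimalSets 𝓕).card : ℕ) : ℝ) := by
    exact_mod_cast hT.sum_card_crossing_le h𝓕 hF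
  push_cast at h1
  have h2 : ((minimalSets 𝓕).card : ℝ) ≤ ∑ e, k e * y e := by
    have hk : ∀ e, (k e : ℝ) * y e
        = ∑ C ∈ minimalSets 𝓕, if Crosses p q C e then y e else 0 := by
      intro e
      rw [← Finset.sum_filter, Finset.sum_const, nsmul_eq_mul]
    simp only [hk]
    rw [Finset.sum_comm, Finset.card_eq_sum_ones]
    push_cast
    refine Finset.sum_le_sum fun C hC => ?_
    rw [← Finset.sum_filter]
    exact hcov C (mem_minimalSets.1 hC).1
  rw [← hwF] at hle
  simp only [Finset.sum_sub_distrib, sub_mul, ← Finset.mul_sum, mul_assoc] at hle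
  have h3 := mul_le_mul_of_nonneg_left h1 ht0
  have h4 := mul_le_mul_of_nonneg_left h2 ht0
  linarith

theorem mem_cutF {V ε : Type} [Fintype ε] {ends : ε → Sym2 V} {U : Set V} {e : ε} :
    e ∈ cutF ends U ↔ ∃ a b, ends e = s(a, b) ∧ a ∈ U ∧ b ∉ U := by
  simp [cutF]

theorem cutF_compl {V ε : Type} [Fintype ε] (ends : ε → Sym2 V) (U : Set V) :
    cutF ends Uᶜ = cutF ends U := by
  ext e
  rw [mem_cutF, mem_cutF]
  constructor <;> rintro ⟨a, b, h, ha, hb⟩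
  · exact ⟨b, a, h.trans Sym2.eq_swap, not_not.1 hb, ha⟩
  · exact ⟨b, a, h.trans Sym2.eq_swap, hb, not_not.2 ha⟩

/-- The vertex set of the component of `a` in the subgraph induced by `U`. -/
def componentIn {V ε : Type} (ends : ε → Sym2 V) (U : Set V) (a : V) : Set V :=
  {x | Relation.ReflTransGen (fun x y => x ∈ U ∧ y ∈ U ∧ ∃ e, ends e = s(x, y)) a x}

theorem self_mem_componentIn {V ε : Type} (ends : ε → Sym2 V) (U : Set V) (a : V) :
    a ∈ componentIn ends U a :=
  Relation.ReflTransGen.refl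

theorem componentIn_subset {V ε : Type} {ends : ε → Sym2 V} {U : Set V} {a : V} (ha : a ∈ U) :
    componentIn ends U a ⊆ U := by
  intro x hx
  rcases Relation.ReflTransGen.cases_tail hx with h | ⟨_, _, h⟩
  · exact h ▸ ha
  · exact h.2.1

theorem mem_componentIn_of_edge {V ε : Type} {ends : ε → Sym2 V} {U : Set V} {a x y : V} {e : ε}
    (ha : a ∈ U) (hx : x ∈ componentIn ends U a) (hy : y ∈ U) (he : ends e = s(x, y)) :
    y ∈ componentIn ends U a :=
  Relation.ReflTransGen.tail hx ⟨componentIn_subset ha hx, hy, e, he⟩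

theorem cutF_componentIn_subset {V ε : Type} [Fintype ε] {ends : ε → Sym2 V} {U : Set V} {a : V}
    (ha : a ∈ U) : cutF ends (componentIn ends U a) ⊆ cutF ends U := by
  intro e he
  obtain ⟨x, y, h, hx, hy⟩ := mem_cutF.1 he
  exact mem_cutF.2 ⟨x, y, h, componentIn_subset ha hx,
    fun hyU => hy (mem_componentIn_of_edge ha hx hyU h)⟩

theorem connectedOn_of_forall {V ε : Type} {ends : ε → Sym2 V} {U : Set V} {a : V} (ha : a ∈ U)
    (h : ∀ x ∈ U, x ∈ componentIn ends U a) : ConnectedOn ends U := by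
  refine ⟨⟨a, ha⟩, fun x hx y hy => (?_ : Relation.ReflTransGen _ x a).trans (h y hy)⟩
  have hsymm : Std.Symm fun x y => x ∈ U ∧ y ∈ U ∧ ∃ e, ends e = s(x, y) :=
    ⟨fun x y ⟨h1, h2, e, he⟩ => ⟨h2, h1, e, he.trans Sym2.eq_swap⟩⟩
  exact Relation.ReflTransGen.stdSymm.symm _ _ (h x hx)

theorem connectedOn_componentIn {V ε : Type} {ends : ε → Sym2 V} {U : Set V} {a : V}
    (ha : a ∈ U) : ConnectedOn ends (componentIn ends U a) := by
  refine connectedOn_of_forall (self_mem_componentIn ends U a) fun x hx => ?_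
  induction hx with
  | refl => exact self_mem_componentIn _ _ _
  | @tail b c hb hbc ih =>
    obtain ⟨-, hc, e, he⟩ := hbc
    exact Relation.ReflTransGen.tail ih ⟨hb, mem_componentIn_of_edge ha hb hc he, e, he⟩

theorem componentIn_mono {V ε : Type} {ends : ε → Sym2 V} {U W : Set V} (h : U ⊆ W) (a : V) :
    componentIn ends U a ⊆ componentIn ends W a :=
  fun _ hx => Relation.ReflTransGen.mono (fun _ _ h' => ⟨h h'.1, h h'.2.1, h'.2.2⟩) _ _ hx

/-- In a connected multigraph, a set leaving out some vertex is left by some edge. -/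
theorem MGConnected.exists_edge {V ε : Type} {ends : ε → Sym2 V} (hconn : MGConnected ends)
    {Z : Set V} {x a : V} (hx : x ∈ Z) (ha : a ∉ Z) :
    ∃ z y e, z ∈ Z ∧ y ∉ Z ∧ ends e = s(z, y) := by
  by_contra hcon
  push Not at hcon
  have hreach := hconn.2 x trivial a trivial
  refine ha ?_
  clear ha
  induction hreach with
  | refl => exact hx
  | @tail b c _ hbc ih =>
    obtain ⟨-, -, e, he⟩ := hbc
    by_contra hc
    exact hcon b c e ih hc he

/-- Every edge of a cut lies in a simple cut contained in that cut. -/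
theorem MGConnected.exists_simpleCut {V ε : Type} [Fintype ε] {ends : ε → Sym2 V}
    (hconn : MGConnected ends) {U : Set V} {d : ε} (hd : d ∈ cutF ends U) :
    ∃ W, IsSimpleCut ends W ∧ cutF ends W ⊆ cutF ends U ∧ d ∈ cutF ends W := by
  obtain ⟨a, b, hab, ha, hb⟩ := mem_cutF.1 hd
  set K := componentIn ends U a with hK
  have haK : a ∈ K := self_mem_componentIn _ _ _
  have hbK : b ∈ Kᶜ := fun h => hb (componentIn_subset ha h)
  set W := componentIn ends Kᶜ b with hW
  have hbW : b ∈ W := self_mem_componentIn _ _ _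
  have hWK : W ⊆ Kᶜ := componentIn_subset hbK
  have hKW : K ⊆ Wᶜ := fun x hx hxW => hWK hxW hx
  have hKconn : ConnectedOn ends K := connectedOn_componentIn ha
  refine ⟨W, ⟨connectedOn_componentIn hbK, ?_⟩, ?_, ?_⟩
  · refine connectedOn_of_forall (hKW haK) fun x hx => ?_
    by_contra hxa
    have hdisj : ∀ z ∈ K, z ∈ componentIn ends Wᶜ a := fun z hz =>
      componentIn_mono hKW a (hKconn.2 a haK z hz)
    obtain ⟨z, y, e, hz, hy, he⟩ := hconn.exists_edge
      (Z := Wᶜ \ componentIn ends Wᶜ a) (a := a) ⟨hx, hxa⟩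
      (fun h => h.2 (self_mem_componentIn _ _ _))
    have hzK : z ∈ Kᶜ := fun h => hz.2 (hdisj z h)
    by_cases hyW : y ∈ W
    · exact hz.1 (mem_componentIn_of_edge hbK hyW hzK (he.trans Sym2.eq_swap))
    · have hyc : y ∈ componentIn ends Wᶜ a := by
        by_contra h
        exact hy ⟨hyW, h⟩
      exact hz.2 (mem_componentIn_of_edge (hKW haK) hyc hz.1 (he.trans Sym2.eq_swap))
  · refine (cutF_componentIn_subset hbK).trans ?_
    rw [cutF_compl]
    exact cutF_componentIn_subset ha
  · exact mem_cutF.2 ⟨b, a, hab.trans Sym2.eq_swap, hbW, hKW haK⟩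

theorem MGConnected.exists_isDCut {V ε : Type} [Fintype ε] [DecidableEq ε] {ends : ε → Sym2 V}
    (hconn : MGConnected ends) {Dem : Finset ε} {U : Set V}
    (hU : (cutF ends U ∩ Dem).card = 1) :
    ∃ W, IsDCut ends Dem W ∧ cutF ends W ⊆ cutF ends U := by
  obtain ⟨d, hd⟩ := Finset.card_pos.1 (hU ▸ Nat.one_pos)
  obtain ⟨hdU, hdD⟩ := Finset.mem_inter.1 hd
  obtain ⟨W, hW, hWU, hdW⟩ := hconn.exists_simpleCut hdU
  refine ⟨W, ⟨hW, le_antisymm ?_ ?_⟩, hWU⟩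
  · exact hU ▸ Finset.card_le_card (Finset.inter_subset_inter_right hWU)
  · exact Finset.card_pos.2 ⟨d, Finset.mem_inter.2 ⟨hdW, hdD⟩⟩

/-- The sets whose cut contains exactly one demand edge form an uncrossable family. -/
theorem isUncrossable_card_filter_eq_one {V ε : Type} [Fintype V] [DecidableEq V]
    (p q : ε → V) (Dem : Finset ε) (r : V) :
    IsUncrossable r (Finset.univ.filter fun U : Finset V =>
      r ∉ U ∧ (Dem.filter (Crosses p q U)).card = 1) := by
  refine ⟨fun U hU => ?_, fun U hU => (Finset.mem_filter.1 hU).2.1, fun A hA B hB => ?_⟩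
  · have h := (Finset.mem_filter.1 hU).2.2
    by_contra hne
    rw [Finset.not_nonempty_iff_eq_empty] at hne
    subst hne
    rw [Finset.filter_false_of_mem fun e _ => by simp [Crosses]] at h
    exact absurd h (by simp)
  have hone : ∀ U : Finset V, (Dem.filter (Crosses p q U)).card = 1 ↔
      ∃ d ∈ Dem, ∀ e ∈ Dem, Crosses p q U e ↔ e = d := by
    intro U
    rw [Finset.card_eq_one]
    refine exists_congr fun d => ?_
    rw [Finset.ext_iff]
    simp only [Finset.mem_filter, Finset.mem_singleton]
    constructor
    · intro h
      exact ⟨((h d).2 rfl).1, fun e he => by simp [← h e, he]⟩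
    · rintro ⟨hd, h⟩ e
      constructor
      · rintro ⟨he, hx⟩
        exact (h e he).1 hx
      · rintro rfl
        exact ⟨hd, (h e hd).2 rfl⟩
  simp only [Finset.mem_filter, Finset.mem_univ, true_and, hone] at hA hB ⊢
  obtain ⟨hrA, a, ha, hAa⟩ := hA
  obtain ⟨hrB, b, hb, hBb⟩ := hB
  have key : ∀ X : Finset V, ∀ c, c ∈ Dem → r ∉ X → Crosses p q X c →
      (∀ e ∈ Dem, e ≠ c → (p e ∈ X ↔ q e ∈ X)) →
      r ∉ X ∧ ∃ d ∈ Dem, ∀ e ∈ Dem, Crosses p q X e ↔ e = d := by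
    intro X c hc hr hX h
    refine ⟨hr, c, hc, fun e he => ⟨fun hx => ?_, fun hx => hx ▸ hX⟩⟩
    by_contra hne
    exact hx (h e he hne)
  unfold Crosses at *
  by_cases hab : a = b
  · subst hab
    by_cases h : p a ∈ A ↔ p a ∈ B
    · exact Or.inl ⟨key _ a ha (by grind) (by grind) (by grind),
        key _ a ha (by grind) (by grind) (by grind)⟩
    · exact Or.inr ⟨key _ a ha (by grind) (by grind) (by grind),
        key _ a ha (by grind) (by grind) (by grind)⟩
  by_cases h1 : p a ∈ B <;> by_cases h2 : p b ∈ A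
  · exact Or.inr ⟨key _ b hb (by grind) (by grind) (by grind),
      key _ a ha (by grind) (by grind) (by grind)⟩
  · exact Or.inl ⟨key _ a ha (by grind) (by grind) (by grind),
      key _ b hb (by grind) (by grind) (by grind)⟩
  · exact Or.inl ⟨key _ b hb (by grind) (by grind) (by grind),
      key _ a ha (by grind) (by grind) (by grind)⟩
  · exact Or.inr ⟨key _ a ha (by grind) (by grind) (by grind),
      key _ b hb (by grind) (by grind) (by grind)⟩

/-- the integrality gap of the `D`-cut covering LP is at most `2`: there is
an integral feasible solution whose value is at most twice the value of every (fractional)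
feasible solution. -/
theorem stmt9 {V ε : Type} [Fintype V] [DecidableEq V] [Fintype ε] [DecidableEq ε]
    (ends : ε → Sym2 V) (Dem : Finset ε)
    (hconn : MGConnected ends) :
    ∃ yint : ε → ℕ,
      (∀ U : Set V, IsDCut ends Dem U → 1 ≤ ∑ e ∈ cutF ends U, yint e) ∧
      ∀ y : ε → ℝ, (∀ e, 0 ≤ y e) →
        (∀ U : Set V, IsDCut ends Dem U → 1 ≤ ∑ e ∈ cutF ends U, y e) →
        (∑ e : ε, (yint e : ℝ)) ≤ 2 * ∑ e : ε, y e := by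
  obtain ⟨r, -⟩ := hconn.1
  have hpq : ∀ e, ∃ a b, ends e = s(a, b) := fun e =>
    Sym2.ind (fun a b => ⟨a, b, rfl⟩) (ends e)
  choose p q hends using hpq
  have hcut : ∀ (U : Finset V) (e : ε), e ∈ cutF ends (U : Set V) ↔ Crosses p q U e := by
    intro U e
    rw [mem_cutF, hends e]
    unfold Crosses
    constructor
    · rintro ⟨a, b, h, ha, hb⟩
      rw [Finset.mem_coe] at ha hb
      rcases Sym2.eq_iff.1 h with ⟨h1, h2⟩ | ⟨h1, h2⟩ <;> rw [h1, h2] <;> tauto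
    · intro h
      by_cases hp : p e ∈ U
      · exact ⟨p e, q e, rfl, hp, fun hq => h (iff_of_true hp hq)⟩
      · refine ⟨q e, p e, Sym2.eq_swap, ?_, hp⟩
        by_contra hq
        exact h (iff_of_false hp hq)
  have hcut' : ∀ U : Finset V, cutF ends (U : Set V) = Finset.univ.filter (Crosses p q U) :=
    fun U => by ext e; simp [hcut]
  have hdem : ∀ U : Finset V,
      cutF ends (U : Set V) ∩ Dem = Dem.filter (Crosses p q U) := by
    intro U
    ext e
    rw [Finset.mem_inter, Finset.mem_filter, hcut, and_comm]
  let 𝓕 : Finset (Finset V) := Finset.univ.filter fun U =>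
    r ∉ U ∧ (Dem.filter (Crosses p q U)).card = 1
  have hcover : ∀ F, IsCover p q 𝓕 F → ∀ U, IsDCut ends Dem U → ∃ e ∈ F, e ∈ cutF ends U := by
    intro F hF U hU
    have hfin : ∀ W : Set V, r ∉ W → (cutF ends W ∩ Dem).card = 1 →
        ∃ e ∈ F, e ∈ cutF ends W := by
      intro W hr hW
      obtain ⟨W, rfl⟩ := W.toFinite.exists_finset_coe
      obtain ⟨e, he, hx⟩ := hF W (Finset.mem_filter.2
        ⟨Finset.mem_univ _, hr, by rw [← hdem]; exact hW⟩)
      exact ⟨e, he, (hcut W e).2 hx⟩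
    by_cases hr : r ∈ U
    · have := hfin Uᶜ (not_not.2 hr) (by rw [cutF_compl]; exact hU.2)
      rwa [cutF_compl] at this
    · exact hfin U hr hU.2
  have huniv : IsCover p q 𝓕 Finset.univ := by
    intro U hU
    obtain ⟨e, he⟩ := Finset.card_pos.1 ((Finset.mem_filter.1 hU).2.2 ▸ Nat.one_pos)
    exact ⟨e, Finset.mem_univ _, (Finset.mem_filter.1 he).2⟩
  obtain ⟨F, hF, hmin⟩ := (Finset.univ.filter (IsCover p q 𝓕)).exists_min_image Finset.card
    ⟨Finset.univ, by simpa using huniv⟩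
  refine ⟨fun e => if e ∈ F then 1 else 0, fun U hU => ?_, fun y hy hfeas => ?_⟩
  · obtain ⟨e, he, heU⟩ := hcover F (Finset.mem_filter.1 hF).2 U hU
    refine le_trans ?_ (Finset.single_le_sum (fun _ _ => Nat.zero_le _) heU)
    simp [he]
  · obtain ⟨F', -, hF', -, hle⟩ := exists_cover_le_two_mul p q r y hy 𝓕
      (isUncrossable_card_filter_eq_one p q Dem r) (fun U hU => by
        obtain ⟨W, hW, hWU⟩ := hconn.exists_isDCut (Dem := Dem) (U := (U : Set V))
          (by rw [hdem]; exact (Finset.mem_filter.1 hU).2.2)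
        rw [← hcut']
        exact (hfeas W hW).trans
          (Finset.sum_le_sum_of_subset_of_nonneg hWU fun e _ _ => hy e)) (fun _ => 1)
      (fun _ => zero_le_one)
    have hcard : (F.card : ℝ) ≤ F'.card := by
      exact_mod_cast hmin F' (by simpa using hF')
    simp only [Finset.sum_const, nsmul_eq_mul, mul_one, one_mul] at hle
    simp only [Nat.cast_ite, Nat.cast_one, Nat.cast_zero, Finset.sum_ite_mem, Finset.univ_inter,
      Finset.sum_const, nsmul_eq_mul, mul_one]
    exact hcard.trans hle

end
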